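/- In the smooth setting described below, the L¹ norm of the solution grows at most exponentially: for every t ∈ [0,T], ∫_ℂ |ω(t,z)| dA(z) ≤ ‖ω₀‖_∞ · e^{t‖ω₀‖_∞} · |supp ω₀|. -/

import Mathlib

open MeasureTheory Complex ENNReal

/-- The Cauchy-type kernel `K(z) = e^{iθ}/(2πz)`. -/
noncomputable def Kker (θ : ℝ) (z : ℂ) : ℂ :=
  Complex.exp (θ * Complex.I) / (2 * Real.pi * z)

/-- The convolution `(K∗f)(x) = ∫ K(x−y) f(y) dA(y)` against Lebesgue measure on `ℂ`. -/
noncomputable def Kconv (θ : ℝ) (f : ℂ → ℂ) (x : ℂ) : ℂ :=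
  ∫ y, Kker θ (x - y) * f y

/-- The Wirtinger derivative `∂F = (∂_x F − i ∂_y F)/2` of `F : ℂ → ℂ` (real `fderiv`). -/
noncomputable def wdz (F : ℂ → ℂ) (z : ℂ) : ℂ :=
  (fderiv ℝ F z 1 - Complex.I * fderiv ℝ F z Complex.I) / 2

/-- The Wirtinger derivative `∂̄F = (∂_x F + i ∂_y F)/2` of `F : ℂ → ℂ` (real `fderiv`). -/
noncomputable def wdbar (F : ℂ → ℂ) (z : ℂ) : ℂ :=
  (fderiv ℝ F z 1 + Complex.I * fderiv ℝ F z Complex.I) / 2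

/-- The sup norm `‖g‖_∞ = sup_z |g z|` of a real valued function on `ℂ`. -/
noncomputable def supNorm (g : ℂ → ℝ) : ℝ := ⨆ z : ℂ, |g z|

/-- The smooth setting of Section 2: `θ ∈ [0,2π]`, `T > 0`, a smooth compactly supported
datum `ω₀`, a smooth compactly supported (in space) solution `ω` of the active scalar
equation `∂_t ω + v·∇ω = 0`, `v(t,·) = K∗ω(t,·)`, `ω(0,·) = ω₀`, and its smooth flow
`X` solving `∂_t X(t,z) = v(t,X(t,z))`, `X(0,z) = z`, where each `X(t,·)` is a
bijective `C¹` map with everywhere positive Jacobian determinant. -/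
structure SmoothSetting where
  θ : ℝ
  hθ : θ ∈ Set.Icc (0 : ℝ) (2 * Real.pi)
  T : ℝ
  hT : 0 < T
  ω₀ : ℂ → ℝ
  hω₀smooth : ContDiff ℝ (⊤ : ℕ∞) ω₀
  hω₀supp : HasCompactSupport ω₀
  ω : ℝ → ℂ → ℝ
  hωsmooth : ContDiff ℝ (⊤ : ℕ∞) (fun p : ℝ × ℂ => ω p.1 p.2)
  hωsupp : ∀ t : ℝ, HasCompactSupport (ω t)
  hωinit : ω 0 = ω₀
  htransport : ∀ t ∈ Set.Icc (0 : ℝ) T, ∀ z : ℂ,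
    deriv (fun s => ω s z) t
      + (Kconv θ (fun y => (ω t y : ℂ)) z).re * fderiv ℝ (ω t) z 1
      + (Kconv θ (fun y => (ω t y : ℂ)) z).im * fderiv ℝ (ω t) z Complex.I = 0
  X : ℝ → ℂ → ℂ
  hXsmooth : ContDiff ℝ (⊤ : ℕ∞) (fun p : ℝ × ℂ => X p.1 p.2)
  hXinit : ∀ z : ℂ, X 0 z = z
  hXflow : ∀ t ∈ Set.Icc (0 : ℝ) T, ∀ z : ℂ,
    deriv (fun s => X s z) t = Kconv θ (fun y => (ω t y : ℂ)) (X t z)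
  hXbij : ∀ t ∈ Set.Icc (0 : ℝ) T, Function.Bijective (X t)
  hXjac : ∀ t ∈ Set.Icc (0 : ℝ) T, ∀ z : ℂ,
    0 < LinearMap.det ((fderiv ℝ (X t) z) : ℂ →ₗ[ℝ] ℂ)

section Kernel

open scoped Convolution

/-- A continuous function on `ℂ` that is `O(‖x‖⁻ⁿ)` at infinity is `O((1 + ‖x‖)⁻ⁿ)` globally. -/
lemma exists_norm_le_div_one_add_norm_pow {h : ℂ → ℂ} (hh : Continuous h) (n : ℕ) {C ρ : ℝ}
    (hb : ∀ x, ρ ≤ ‖x‖ → ‖h x‖ * ‖x‖ ^ n ≤ C) :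
    ∃ C', ∀ x, ‖h x‖ ≤ C' / (1 + ‖x‖) ^ n := by
  obtain ⟨C₁, hC₁⟩ := (isCompact_closedBall (0 : ℂ) (max ρ 1)).exists_bound_of_continuousOn
    (f := fun x => ‖h x‖ * (1 + ‖x‖) ^ n) (by fun_prop)
  refine ⟨max C₁ (2 ^ n * C), fun x => ?_⟩
  rw [le_div_iff₀ (by positivity)]
  rcases le_total ‖x‖ (max ρ 1) with hx | hx
  · exact ((le_abs_self _).trans (hC₁ x (by simpa using hx))).trans (le_max_left _ _)
  · refine le_trans ?_ (le_max_right _ _)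
    have h1 : 1 ≤ ‖x‖ := (le_max_right _ _).trans hx
    calc ‖h x‖ * (1 + ‖x‖) ^ n ≤ ‖h x‖ * (2 * ‖x‖) ^ n := by gcongr; linarith
      _ = 2 ^ n * (‖h x‖ * ‖x‖ ^ n) := by ring
      _ ≤ 2 ^ n * C := by gcongr; exact hb x ((le_max_left _ _).trans hx)

lemma measurable_Kker (θ : ℝ) : Measurable (Kker θ) := by
  unfold Kker; fun_prop

lemma norm_Kker (θ : ℝ) (z : ℂ) : ‖Kker θ z‖ = (2 * Real.pi)⁻¹ * ‖z‖⁻¹ := by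
  simp [Kker, Complex.norm_exp, abs_of_pos Real.pi_pos, mul_comm]

lemma locallyIntegrable_Kker (θ : ℝ) : LocallyIntegrable (Kker θ) := by
  refine locallyIntegrable_of_norm_le_rpow (C := (2 * Real.pi)⁻¹) (α := 1) (by simp) (by simp)
    (Filter.Eventually.of_forall fun z => ?_) (measurable_Kker θ).aestronglyMeasurable
  rw [norm_Kker, Real.rpow_neg_one]

lemma Kconv_eq_convolution (θ : ℝ) (f : ℂ → ℂ) :
    Kconv θ f = Kker θ ⋆[ContinuousLinearMap.mul ℝ ℂ, volume] f := by
  ext x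
  rw [convolution_eq_swap]
  rfl

variable {f : ℂ → ℂ}

lemma continuous_Kconv (θ : ℝ) (hf : Continuous f) (hc : HasCompactSupport f) :
    Continuous (Kconv θ f) := by
  rw [Kconv_eq_convolution]
  exact hc.continuous_convolution_right _ (locallyIntegrable_Kker θ) hf

lemma contDiff_Kconv (θ : ℝ) {n : ℕ∞} (hf : ContDiff ℝ n f) (hc : HasCompactSupport f) :
    ContDiff ℝ n (Kconv θ f) := by
  rw [Kconv_eq_convolution]
  exact hc.contDiff_convolution_right _ (locallyIntegrable_Kker θ) hf

lemma fderiv_Kconv (θ : ℝ) (hf : ContDiff ℝ 1 f) (hc : HasCompactSupport f) (x h : ℂ) :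
    fderiv ℝ (Kconv θ f) x h = Kconv θ (fun y => fderiv ℝ f y h) x := by
  rw [Kconv_eq_convolution, Kconv_eq_convolution,
    (hc.hasFDerivAt_convolution_right _ (locallyIntegrable_Kker θ) hf x).fderiv,
    convolution_precompR_apply _ (locallyIntegrable_Kker θ) (hc.fderiv ℝ)
      (hf.continuous_fderiv one_ne_zero)]

lemma integrable_Kker_sub_mul (θ : ℝ) (hf : Continuous f) (hc : HasCompactSupport f) (x : ℂ) :
    Integrable fun y => Kker θ (x - y) * f y := by
  have := (hc.convolutionExists_right (ContinuousLinearMap.mul ℝ ℂ) (locallyIntegrable_Kker θ)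
    hf x).integrable_swap
  exact this

lemma norm_Kker_sub_sub_le (θ : ℝ) {R : ℝ} {x y : ℂ} (hR : 0 < R) (hy : ‖y‖ ≤ R)
    (hx : 2 * R ≤ ‖x‖) : ‖Kker θ (x - y) - Kker θ x‖ ≤ R / ‖x‖ ^ 2 := by
  have hx0 : 0 < ‖x‖ := by linarith
  have hxy : ‖x‖ / 2 ≤ ‖x - y‖ := by
    have := norm_sub_norm_le x y
    linarith
  have hxy0 : 0 < ‖x - y‖ := by linarith
  have hx' : x ≠ 0 := norm_pos_iff.1 hx0
  have hxy' : x - y ≠ 0 := norm_pos_iff.1 hxy0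
  have hpi : (Real.pi : ℂ) ≠ 0 := by exact_mod_cast Real.pi_ne_zero
  have heq : Kker θ (x - y) - Kker θ x = Kker θ x * (y / (x - y)) := by
    unfold Kker
    field_simp
    ring
  have h1 : ‖y‖ / ‖x - y‖ ≤ R / (‖x‖ / 2) := by gcongr
  have h2 : (2 * Real.pi)⁻¹ ≤ 1 / 2 := by
    rw [inv_le_comm₀ (by positivity) (by norm_num)]
    linarith [Real.pi_gt_three]
  rw [heq, norm_mul, norm_Kker, norm_div]
  calc (2 * Real.pi)⁻¹ * ‖x‖⁻¹ * (‖y‖ / ‖x - y‖) ≤ 1 / 2 * ‖x‖⁻¹ * (R / (‖x‖ / 2)) := by gcongr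
    _ = R / ‖x‖ ^ 2 := by field_simp

/-- Far from the support of `f`, the convolution `K ∗ f` is close to `(∫ f) K`. -/
lemma exists_norm_Kconv_sub_le (θ : ℝ) (hf : Continuous f) (hc : HasCompactSupport f) :
    ∃ C R : ℝ, 0 < R ∧ ∀ x, R ≤ ‖x‖ →
      ‖Kconv θ f x - Kker θ x * ∫ y, f y‖ ≤ C / ‖x‖ ^ 2 := by
  obtain ⟨R, hR0, hR⟩ := hc.isCompact.isBounded.exists_pos_norm_le
  have hint := hf.integrable_of_hasCompactSupport (μ := volume) hc
  refine ⟨R * ∫ y, ‖f y‖, 2 * R, by positivity, fun x hx => ?_⟩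
  rw [Kconv, ← integral_const_mul, ← integral_sub (integrable_Kker_sub_mul θ hf hc x)
    (hint.const_mul _), mul_div_right_comm, ← integral_const_mul]
  refine norm_integral_le_of_norm_le (hint.norm.const_mul _) (Filter.Eventually.of_forall fun y => ?_)
  rw [← sub_mul, norm_mul]
  by_cases hy : y ∈ tsupport f
  · gcongr
    exact norm_Kker_sub_sub_le θ hR0 (hR y hy) hx
  · simp [image_eq_zero_of_notMem_tsupport hy]

lemma exists_norm_Kconv_le_div (θ : ℝ) (hf : Continuous f) (hc : HasCompactSupport f) :
    ∃ C, ∀ x, ‖Kconv θ f x‖ ≤ C / (1 + ‖x‖) := by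
  obtain ⟨C, R, hR, h⟩ := exists_norm_Kconv_sub_le θ hf hc
  obtain ⟨C', hC'⟩ := exists_norm_le_div_one_add_norm_pow (continuous_Kconv θ hf hc) 1
    (C := |C| / R + (2 * Real.pi)⁻¹ * ‖∫ y, f y‖) (ρ := R) fun x hx => by
      have hx0 : 0 < ‖x‖ := hR.trans_le hx
      have h1 := norm_sub_norm_le (Kconv θ f x) (Kker θ x * ∫ y, f y)
      have h2 : ‖Kconv θ f x‖ ≤ |C| / ‖x‖ ^ 2 + (2 * Real.pi)⁻¹ * ‖x‖⁻¹ * ‖∫ y, f y‖ := by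
        rw [norm_mul, norm_Kker] at h1
        have h3 : C / ‖x‖ ^ 2 ≤ |C| / ‖x‖ ^ 2 := by gcongr; exact le_abs_self C
        linarith [h x hx]
      calc ‖Kconv θ f x‖ * ‖x‖ ^ 1
          ≤ (|C| / ‖x‖ ^ 2 + (2 * Real.pi)⁻¹ * ‖x‖⁻¹ * ‖∫ y, f y‖) * ‖x‖ ^ 1 := by gcongr
        _ = |C| / ‖x‖ + (2 * Real.pi)⁻¹ * ‖∫ y, f y‖ := by field_simp
        _ ≤ _ := by gcongr
  exact ⟨C', fun x => by simpa using hC' x⟩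

lemma exists_norm_Kconv_le_div_sq (θ : ℝ) (hf : Continuous f) (hc : HasCompactSupport f)
    (h0 : ∫ y, f y = 0) : ∃ C, ∀ x, ‖Kconv θ f x‖ ≤ C / (1 + ‖x‖) ^ 2 := by
  obtain ⟨C, R, hR, h⟩ := exists_norm_Kconv_sub_le θ hf hc
  refine exists_norm_le_div_one_add_norm_pow (continuous_Kconv θ hf hc) 2 (C := C) (ρ := R)
    fun x hx => ?_
  have := h x hx
  rwa [h0, mul_zero, sub_zero, le_div_iff₀ (pow_pos (hR.trans_le hx) 2)] at this

lemma integral_fderiv_apply_eq_zero (hf : ContDiff ℝ 1 f) (hc : HasCompactSupport f) (h : ℂ) :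
    ∫ y, fderiv ℝ f y h = 0 := by
  have hc' : HasCompactSupport fun y => fderiv ℝ f y h := hc.fderiv_apply ℝ h
  have hcont : Continuous fun y => fderiv ℝ f y h :=
    (hf.continuous_fderiv one_ne_zero).clm_apply continuous_const
  have := integral_mul_fderiv_eq_neg_fderiv_mul_of_integrable (μ := volume) (f := fun _ => (1 : ℂ))
    (g := f) (v := h) (by simp) (by simpa using hcont.integrable_of_hasCompactSupport hc')
    (by simpa using hf.continuous.integrable_of_hasCompactSupport hc)
    (fun x _ => by fun_prop) (fun x _ => hf.differentiable one_ne_zero x)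
  simpa using this

end Kernel

section CauchyPompeiu

variable {g : ℂ → ℂ}

lemma integrableOn_polarCoord_target_of_eq_zero {F : ℝ × ℝ → ℂ} (hF : Continuous F) {R : ℝ}
    (h0 : ∀ p, R < p.1 → F p = 0) : IntegrableOn F polarCoord.target := by
  refine IntegrableOn.of_forall_sdiff_eq_zero
    (hF.continuousOn.integrableOn_compact (isCompact_Icc (a := (0, -Real.pi)) (b := (R, Real.pi))))
    polarCoord.open_target.measurableSet fun p hp => h0 p ?_
  obtain ⟨⟨hp1, hp2⟩, hp3⟩ := hp
  by_contra! hle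
  exact hp3 ⟨⟨le_of_lt hp1, hp2.1.le⟩, ⟨hle, hp2.2.le⟩⟩

lemma integral_Ioi_radial_fderiv (hg : ContDiff ℝ 1 g) (hc : HasCompactSupport g) {e : ℂ}
    (he : ‖e‖ = 1) : ∫ r in Set.Ioi (0 : ℝ), fderiv ℝ g (r * e) e = -g 0 := by
  have hd : ∀ r : ℝ, HasDerivAt (fun r : ℝ => g (r * e)) (fderiv ℝ g (r * e) e) r := fun r => by
    have h1 : HasDerivAt (fun r : ℝ => (r : ℂ) * e) e r := by
      simpa using (Complex.ofRealCLM.hasDerivAt (x := r)).mul_const e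
    exact (hg.differentiable one_ne_zero _).hasFDerivAt.comp_hasDerivAt r h1
  have hemb : Topology.IsClosedEmbedding fun r : ℝ => (r : ℂ) * e := by
    refine Isometry.isClosedEmbedding (Isometry.of_dist_eq fun a b => ?_)
    rw [dist_eq_norm, ← sub_mul, norm_mul, he, mul_one, ← Complex.ofReal_sub, Complex.norm_real,
      dist_eq_norm]
  have hcomp : HasCompactSupport fun r : ℝ => g (r * e) := hc.comp_isClosedEmbedding hemb
  have hcd : ContDiff ℝ 1 fun r : ℝ => g (r * e) := by
    have : ContDiff ℝ 1 fun r : ℝ => (r : ℂ) * e := Complex.ofRealCLM.contDiff.mul contDiff_const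
    exact hg.comp this
  have := hcomp.integral_Ioi_deriv_eq hcd 0
  simp only [fun r => (hd r).deriv] at this
  simpa using this

lemma integral_Ioo_angular_fderiv (hg : ContDiff ℝ 1 g) {r : ℝ} (hr : 0 < r) :
    ∫ φ in Set.Ioo (-Real.pi) Real.pi,
      fderiv ℝ g (r * Complex.exp (φ * Complex.I)) (Complex.I * Complex.exp (φ * Complex.I)) = 0 := by
  have hd : ∀ φ : ℝ, HasDerivAt (fun φ : ℝ => g (r * Complex.exp (φ * Complex.I)))
      (r • fderiv ℝ g (r * Complex.exp (φ * Complex.I))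
        (Complex.I * Complex.exp (φ * Complex.I))) φ := fun φ => by
    have h1 : HasDerivAt (fun φ : ℝ => (r : ℂ) * Complex.exp (φ * Complex.I))
        (r • (Complex.I * Complex.exp (φ * Complex.I))) φ := by
      have h2 := ((Complex.ofRealCLM.hasDerivAt (x := φ)).mul_const Complex.I).cexp.const_mul (r : ℂ)
      refine h2.congr_deriv ?_
      simp only [Complex.ofRealCLM_apply, Complex.ofReal_one, one_mul, Complex.real_smul]
      ring
    rw [← map_smul]
    exact (hg.differentiable one_ne_zero _).hasFDerivAt.comp_hasDerivAt φ h1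
  have hcont : Continuous fun φ : ℝ => fderiv ℝ g (r * Complex.exp (φ * Complex.I))
      (Complex.I * Complex.exp (φ * Complex.I)) :=
    ((hg.continuous_fderiv one_ne_zero).comp (by fun_prop)).clm_apply (by fun_prop)
  have hint := intervalIntegral.integral_eq_sub_of_hasDerivAt (a := -Real.pi) (b := Real.pi)
    (fun φ _ => hd φ) ((hcont.const_smul r).intervalIntegrable _ _)
  rw [intervalIntegral.integral_smul, intervalIntegral.integral_of_le (by linarith [Real.pi_pos]),
    integral_Ioc_eq_integral_Ioo] at hint
  have h0 : Complex.exp (((-Real.pi : ℝ) : ℂ) * Complex.I) = Complex.exp ((Real.pi : ℂ) * Complex.I) := by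
    rw [Complex.ofReal_neg, neg_mul, Complex.exp_neg, Complex.exp_pi_mul_I]
    norm_num
  rw [h0, sub_self] at hint
  exact (smul_eq_zero.1 hint).resolve_left hr.ne'

/-- The Cauchy–Pompeiu formula for compactly supported functions. -/
lemma integral_inv_mul_dbar (hg : ContDiff ℝ 1 g) (hc : HasCompactSupport g) :
    ∫ z, z⁻¹ * (fderiv ℝ g z 1 + Complex.I * fderiv ℝ g z Complex.I) = -(2 * Real.pi * g 0) := by
  obtain ⟨R, hR0, hR⟩ := (hc.fderiv ℝ).isCompact.isBounded.exists_pos_norm_le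
  let e : ℝ → ℂ := fun φ => Complex.exp (φ * Complex.I)
  have hen : ∀ φ, ‖e φ‖ = 1 := fun φ => Complex.norm_exp_ofReal_mul_I φ
  have hec : Continuous e := by fun_prop
  let u : ℝ × ℝ → ℂ := fun p => fderiv ℝ g (p.1 * e p.2) (e p.2)
  let w : ℝ × ℝ → ℂ := fun p => fderiv ℝ g (p.1 * e p.2) (Complex.I * e p.2)
  have hD : Continuous fun p : ℝ × ℝ => fderiv ℝ g (p.1 * e p.2) :=
    (hg.continuous_fderiv one_ne_zero).comp (by fun_prop)
  have huc : Continuous u := hD.clm_apply (by fun_prop)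
  have hwc : Continuous w := hD.clm_apply (by fun_prop)
  have hzero : ∀ p : ℝ × ℝ, R < p.1 → fderiv ℝ g (p.1 * e p.2) = 0 := fun p hp => by
    refine image_eq_zero_of_notMem_tsupport fun hmem => ?_
    have := hR _ hmem
    rw [norm_mul, hen, mul_one, Complex.norm_real] at this
    linarith [le_abs_self p.1, Real.norm_eq_abs p.1]
  have hui : IntegrableOn u polarCoord.target :=
    integrableOn_polarCoord_target_of_eq_zero (R := R) huc fun p hp => by simp [u, hzero p hp]
  have hwi : IntegrableOn w polarCoord.target :=
    integrableOn_polarCoord_target_of_eq_zero (R := R) hwc fun p hp => by simp [w, hzero p hp]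
  have hpolar : ∀ p ∈ polarCoord.target,
      p.1 • ((Complex.polarCoord.symm p)⁻¹ * (fderiv ℝ g (Complex.polarCoord.symm p) 1
        + Complex.I * fderiv ℝ g (Complex.polarCoord.symm p) Complex.I)) =
      u p + Complex.I * w p := by
    rintro ⟨r, φ⟩ ⟨hr, -⟩
    have hr' : (r : ℂ) ≠ 0 := by exact_mod_cast (ne_of_gt hr)
    have he0 : e φ ≠ 0 := Complex.exp_ne_zero _
    have hsymm : Complex.polarCoord.symm (r, φ) = r * e φ := by
      simp [e, Complex.exp_mul_I]
    have hee : e φ = (Real.cos φ : ℂ) + Real.sin φ * Complex.I := by simp [e, Complex.exp_mul_I]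
    have hcs : (Real.cos φ : ℂ) ^ 2 + (Real.sin φ : ℂ) ^ 2 = 1 := by
      exact_mod_cast Real.cos_sq_add_sin_sq φ
    have h1 : (1 : ℂ) = Real.cos φ • e φ - Real.sin φ • (Complex.I * e φ) := by
      simp only [Complex.real_smul, hee]
      linear_combination -hcs + (Real.sin φ : ℂ) ^ 2 * Complex.I_sq
    have hI : Complex.I = Real.sin φ • e φ + Real.cos φ • (Complex.I * e φ) := by
      simp only [Complex.real_smul, hee]
      linear_combination -Complex.I * hcs - (Real.cos φ : ℂ) * (Real.sin φ : ℂ) * Complex.I_sq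
    have hL1 : fderiv ℝ g (r * e φ) 1 = Real.cos φ * u (r, φ) - Real.sin φ * w (r, φ) := by
      conv_lhs => rw [h1]
      simp only [map_sub, map_smul, u, w]
      simp only [Complex.real_smul]
    have hLI : fderiv ℝ g (r * e φ) Complex.I = Real.sin φ * u (r, φ) + Real.cos φ * w (r, φ) := by
      conv_lhs => rw [hI]
      simp only [map_add, map_smul, u, w]
      simp only [Complex.real_smul]
    rw [hsymm, hL1, hLI, Complex.real_smul, mul_inv]
    have : Real.cos φ * u (r, φ) - Real.sin φ * w (r, φ)
        + Complex.I * (Real.sin φ * u (r, φ) + Real.cos φ * w (r, φ))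
        = e φ * (u (r, φ) + Complex.I * w (r, φ)) := by
      rw [hee]
      linear_combination -(Real.sin φ : ℂ) * w (r, φ) * Complex.I_sq
    rw [this]
    field_simp
  rw [← Complex.integral_comp_polarCoord_symm,
    setIntegral_congr_fun polarCoord.open_target.measurableSet hpolar,
    integral_add hui (hwi.const_mul _), integral_const_mul]
  have hU : ∫ p in polarCoord.target, u p = -(2 * Real.pi * g 0) := by
    rw [polarCoord_target, Measure.volume_eq_prod, ← Measure.prod_restrict, integral_prod_symm]
    · simp only [u, integral_Ioi_radial_fderiv hg hc (hen _)]
      rw [setIntegral_const]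
      simp [Measure.real, Real.pi_pos.le, two_mul]
    · rw [Measure.prod_restrict, ← Measure.volume_eq_prod]
      exact hui
  have hW : ∫ p in polarCoord.target, w p = 0 := by
    rw [polarCoord_target, Measure.volume_eq_prod, setIntegral_prod]
    · exact setIntegral_eq_zero_of_forall_eq_zero fun r hr => integral_Ioo_angular_fderiv hg hr
    · rw [← Measure.volume_eq_prod]
      exact hwi
  rw [hU, hW, mul_zero, add_zero]

/-- The Cauchy transform solves the `∂̄` equation: `2 ∂̄ (K ∗ f) = e^{iθ} f`. -/
lemma dbar_Kconv (θ : ℝ) {f : ℂ → ℂ} (hf : ContDiff ℝ 1 f) (hc : HasCompactSupport f) (x : ℂ) :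
    fderiv ℝ (Kconv θ f) x 1 + Complex.I * fderiv ℝ (Kconv θ f) x Complex.I =
      Complex.exp (θ * Complex.I) * f x := by
  have hcont : ∀ h : ℂ, Continuous fun y => fderiv ℝ f y h := fun h =>
    (hf.continuous_fderiv one_ne_zero).clm_apply continuous_const
  have hint : ∀ h : ℂ, Integrable fun y => Kker θ (x - y) * fderiv ℝ f y h := fun h =>
    integrable_Kker_sub_mul θ (hcont h) (hc.fderiv_apply ℝ h) x
  let g : ℂ → ℂ := fun z => f (x - z)
  have hg : ContDiff ℝ 1 g := hf.comp (by fun_prop)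
  have hgc : HasCompactSupport g := hc.comp_homeomorph (Homeomorph.subLeft x)
  have hgd : ∀ z h, fderiv ℝ g z h = -fderiv ℝ f (x - z) h := fun z h => by
    have := (hf.differentiable one_ne_zero (x - z)).hasFDerivAt.comp z
      ((hasFDerivAt_id z).const_sub x)
    rw [HasFDerivAt.fderiv (f := g) this]
    simp
  have hpi : (Real.pi : ℂ) ≠ 0 := by exact_mod_cast Real.pi_ne_zero
  rw [fderiv_Kconv θ hf hc, fderiv_Kconv θ hf hc, Kconv, Kconv, ← integral_const_mul,
    ← integral_add (hint 1) ((hint Complex.I).const_mul _),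
    ← integral_sub_left_eq_self _ volume x]
  have := integral_inv_mul_dbar hg hgc
  calc _ = ∫ z, -(Complex.exp (θ * Complex.I) / (2 * Real.pi)) *
        (z⁻¹ * (fderiv ℝ g z 1 + Complex.I * fderiv ℝ g z Complex.I)) := by
        refine integral_congr_ae (Filter.Eventually.of_forall fun z => ?_)
        simp only [hgd, Kker]
        ring
    _ = _ := by
        rw [integral_const_mul, this]
        simp only [g, sub_zero]
        field_simp

end CauchyPompeiu

section DivergenceEstimate

lemma integrable_of_norm_le_div_one_add_norm_cube {h : ℂ → ℝ} (hh : Continuous h) {C : ℝ}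
    (hb : ∀ x, |h x| ≤ C / (1 + ‖x‖) ^ 3) : Integrable h := by
  have h3 : Integrable fun x : ℂ => (1 + ‖x‖) ^ (-3 : ℝ) :=
    integrable_one_add_norm (by rw [Complex.finrank_real_complex]; norm_num)
  refine (h3.const_mul C).mono' hh.aestronglyMeasurable (Filter.Eventually.of_forall fun x => ?_)
  rw [Real.rpow_neg (by positivity), ← div_eq_mul_inv]
  exact_mod_cast hb x

lemma integrable_mul_of_decay {p q : ℂ → ℝ} (hp : Continuous p) (hq : Continuous q) {A B : ℝ}
    (hpb : ∀ x, |p x| ≤ A / (1 + ‖x‖)) (hqb : ∀ x, |q x| ≤ B / (1 + ‖x‖) ^ 2) :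
    Integrable fun x => p x * q x := by
  refine integrable_of_norm_le_div_one_add_norm_cube (C := A * B) (by fun_prop) fun x => ?_
  rw [abs_mul]
  calc |p x| * |q x| ≤ A / (1 + ‖x‖) * (B / (1 + ‖x‖) ^ 2) :=
        mul_le_mul (hpb x) (hqb x) (abs_nonneg _) ((abs_nonneg _).trans (hpb x))
    _ = A * B / (1 + ‖x‖) ^ 3 := by
        have : 0 < 1 + ‖x‖ := by positivity
        field_simp

lemma div_one_add_norm_sq_le {A : ℝ} {a : ℝ} {x : ℂ} (h : |a| ≤ A / (1 + ‖x‖) ^ 2) :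
    |a| ≤ A / (1 + ‖x‖) := by
  have h1 : 0 < 1 + ‖x‖ := by positivity
  rw [le_div_iff₀ (by positivity)] at h ⊢
  have h2 : 0 ≤ |a| * (1 + ‖x‖) * ‖x‖ := by positivity
  nlinarith

variable {v : ℂ → ℂ}

lemma fderiv_re_apply (hv : Differentiable ℝ v) (x h : ℂ) :
    fderiv ℝ (fun y => (v y).re) x h = (fderiv ℝ v x h).re := by
  have := (Complex.reCLM.hasFDerivAt (x := v x)).comp x (hv x).hasFDerivAt
  rw [HasFDerivAt.fderiv (f := fun y => (v y).re) this]
  rfl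

lemma fderiv_im_apply (hv : Differentiable ℝ v) (x h : ℂ) :
    fderiv ℝ (fun y => (v y).im) x h = (fderiv ℝ v x h).im := by
  have := (Complex.imCLM.hasFDerivAt (x := v x)).comp x (hv x).hasFDerivAt
  rw [HasFDerivAt.fderiv (f := fun y => (v y).im) this]
  rfl

lemma fderiv_fderiv_apply_comm (hv : ContDiff ℝ 2 v) (x h k : ℂ) :
    fderiv ℝ (fun y => fderiv ℝ v y h) x k = fderiv ℝ (fun y => fderiv ℝ v y k) x h := by
  have hd : DifferentiableAt ℝ (fderiv ℝ v) x :=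
    (hv.fderiv_right (m := 1) (by norm_num)).differentiable one_ne_zero x
  have hsymm : IsSymmSndFDerivAt ℝ v x :=
    hv.contDiffAt.isSymmSndFDerivAt (by simp)
  rw [fderiv_clm_apply hd (differentiableAt_const h), fderiv_clm_apply hd (differentiableAt_const k)]
  simpa using hsymm.eq k h

/-- The Jacobian determinant of a decaying planar vector field has zero integral. -/
lemma integral_jacobian_eq_zero (hv : ContDiff ℝ 2 v) {A B D : ℝ}
    (hA : ∀ x, ‖v x‖ ≤ A / (1 + ‖x‖))
    (hB : ∀ h ∈ ({1, Complex.I} : Set ℂ), ∀ x, ‖fderiv ℝ v x h‖ ≤ B / (1 + ‖x‖) ^ 2)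
    (hD : ∀ x, ‖fderiv ℝ (fun y => fderiv ℝ v y 1) x Complex.I‖ ≤ D / (1 + ‖x‖) ^ 2) :
    Integrable (fun x => (fderiv ℝ v x 1).re * (fderiv ℝ v x Complex.I).im
      - (fderiv ℝ v x Complex.I).re * (fderiv ℝ v x 1).im) ∧
    ∫ x, ((fderiv ℝ v x 1).re * (fderiv ℝ v x Complex.I).im
      - (fderiv ℝ v x Complex.I).re * (fderiv ℝ v x 1).im) = 0 := by
  have hd : Differentiable ℝ v := hv.differentiable two_ne_zero
  have hP : ∀ h : ℂ, ContDiff ℝ 1 fun y => fderiv ℝ v y h := fun h =>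
    (hv.fderiv_right (m := 1) (by norm_num)).clm_apply contDiff_const
  have hPd : ∀ h : ℂ, Differentiable ℝ fun y => fderiv ℝ v y h := fun h =>
    (hP h).differentiable one_ne_zero
  have hPc : ∀ h : ℂ, Continuous fun y => fderiv ℝ v y h := fun h => (hP h).continuous
  have hmix : Continuous fun x => fderiv ℝ (fun y => fderiv ℝ v y 1) x Complex.I :=
    ((hP 1).continuous_fderiv one_ne_zero).clm_apply continuous_const
  have hre : Continuous fun x => (v x).re := Complex.continuous_re.comp hd.continuous
  have hprod : ∀ h ∈ ({1, Complex.I} : Set ℂ), ∀ k ∈ ({1, Complex.I} : Set ℂ),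
      Integrable fun x => (fderiv ℝ v x h).re * (fderiv ℝ v x k).im := fun h hh k hk =>
    integrable_mul_of_decay (Complex.continuous_re.comp (hPc h))
      (Complex.continuous_im.comp (hPc k))
      (fun x => div_one_add_norm_sq_le ((Complex.abs_re_le_norm _).trans (hB h hh x)))
      (fun x => (Complex.abs_im_le_norm _).trans (hB k hk x))
  have hmul : ∀ k ∈ ({1, Complex.I} : Set ℂ), Integrable fun x => (v x).re * (fderiv ℝ v x k).im :=
    fun k hk => integrable_mul_of_decay hre (Complex.continuous_im.comp (hPc k))
      (fun x => (Complex.abs_re_le_norm _).trans (hA x))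
      (fun x => (Complex.abs_im_le_norm _).trans (hB k hk x))
  have hmul' : Integrable fun x =>
      (v x).re * (fderiv ℝ (fun y => fderiv ℝ v y 1) x Complex.I).im :=
    integrable_mul_of_decay hre (Complex.continuous_im.comp hmix)
      (fun x => (Complex.abs_re_le_norm _).trans (hA x))
      (fun x => (Complex.abs_im_le_norm _).trans (hD x))
  have h1I := hprod 1 (by simp) Complex.I (by simp)
  have hI1 := hprod Complex.I (by simp) 1 (by simp)
  have parts : ∀ h ∈ ({1, Complex.I} : Set ℂ), ∀ k ∈ ({1, Complex.I} : Set ℂ),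
      (∀ x, fderiv ℝ (fun y => fderiv ℝ v y k) x h =
        fderiv ℝ (fun y => fderiv ℝ v y 1) x Complex.I) →
      ∫ x, (fderiv ℝ v x h).re * (fderiv ℝ v x k).im =
        -∫ x, (v x).re * (fderiv ℝ (fun y => fderiv ℝ v y 1) x Complex.I).im := by
    intro h hh k hk heq
    have := integral_mul_fderiv_eq_neg_fderiv_mul_of_integrable (μ := volume)
      (f := fun x => (v x).re) (g := fun x => (fderiv ℝ v x k).im) (v := h)
      (by simpa only [fderiv_re_apply hd] using hprod h hh k hk)
      (by simpa only [fderiv_im_apply (hPd k), heq] using hmul')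
      (hmul k hk)
      (fun x _ => (Complex.reCLM.differentiable.comp hd) x)
      (fun x _ => (Complex.imCLM.differentiable.comp (hPd k)) x)
    simp only [fderiv_re_apply hd, fderiv_im_apply (hPd k), heq] at this
    rw [this, neg_neg]
  refine ⟨h1I.sub hI1, ?_⟩
  rw [integral_sub h1I hI1,
    parts 1 (by simp) Complex.I (by simp) fun x => fderiv_fderiv_apply_comm hv x _ _,
    parts Complex.I (by simp) 1 (by simp) fun x => rfl, sub_self]

lemma add_sq_le_of_add_I_mul_eq {P Q e : ℂ} {r : ℝ} (he : ‖e‖ = 1)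
    (h : P + Complex.I * Q = e * r) :
    (P.re + Q.im) ^ 2 ≤ r ^ 2 + 4 * (P.re * Q.im - Q.re * P.im) := by
  have h1 := congrArg Complex.normSq h
  rw [Complex.normSq_mul, Complex.normSq_eq_norm_sq e, he, Complex.normSq_ofReal,
    Complex.normSq_apply] at h1
  simp only [Complex.add_re, Complex.add_im, Complex.mul_re, Complex.mul_im, Complex.I_re,
    Complex.I_im] at h1
  nlinarith [sq_nonneg (P.im - Q.re)]

/-- The `L²` bound for the divergence of `K ∗ f`, reflecting that the Beurling transform is an
isometry of `L²`. -/
lemma integral_div_Kconv_sq_le (θ : ℝ) {f : ℂ → ℝ} (hf : ContDiff ℝ (⊤ : ℕ∞) f)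
    (hc : HasCompactSupport f) (hvf : v = Kconv θ fun y => (f y : ℂ)) :
    Integrable (fun x => ((fderiv ℝ v x 1).re + (fderiv ℝ v x Complex.I).im) ^ 2) ∧
      ∫ x, ((fderiv ℝ v x 1).re + (fderiv ℝ v x Complex.I).im) ^ 2 ≤ ∫ x, f x ^ 2 := by
  obtain ⟨F, hFf⟩ : ∃ F : ℂ → ℂ, F = fun y => (f y : ℂ) := ⟨_, rfl⟩
  rw [← hFf] at hvf
  have hF : ContDiff ℝ (⊤ : ℕ∞) F := hFf ▸ Complex.ofRealCLM.contDiff.comp hf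
  have hF2 : ContDiff ℝ 2 F := by exact_mod_cast contDiff_infty.1 hF 2
  have hF1 : ContDiff ℝ 1 F := hF2.of_le (by norm_num)
  have hFc : HasCompactSupport F :=
    hFf ▸ hc.comp_left (g := fun r : ℝ => (r : ℂ)) Complex.ofReal_zero
  have hFh : ∀ h : ℂ, ContDiff ℝ 1 fun y => fderiv ℝ F y h := fun h =>
    (hF2.fderiv_right (m := 1) (by norm_num)).clm_apply contDiff_const
  have hFhc : ∀ h : ℂ, HasCompactSupport fun y => fderiv ℝ F y h := fun h => hFc.fderiv_apply ℝ h
  have hvd : ∀ h : ℂ, (fun x => fderiv ℝ v x h) = Kconv θ fun y => fderiv ℝ F y h := fun h =>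
    funext fun x => hvf ▸ fderiv_Kconv θ hF1 hFc x h
  have hv : ContDiff ℝ 2 v := hvf ▸ contDiff_Kconv (n := 2) θ hF2 hFc
  obtain ⟨A, hA⟩ := exists_norm_Kconv_le_div θ hF1.continuous hFc
  rw [← hvf] at hA
  have hdecay : ∀ h : ℂ, ∃ B, ∀ x, ‖fderiv ℝ v x h‖ ≤ B / (1 + ‖x‖) ^ 2 := fun h => by
    obtain ⟨B, hB⟩ := exists_norm_Kconv_le_div_sq θ (hFh h).continuous (hFhc h)
      (integral_fderiv_apply_eq_zero hF1 hFc h)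
    exact ⟨B, fun x => by simpa only [← hvd] using hB x⟩
  obtain ⟨B₁, hB₁⟩ := hdecay 1
  obtain ⟨B₂, hB₂⟩ := hdecay Complex.I
  obtain ⟨D, hD⟩ := exists_norm_Kconv_le_div_sq θ
    (((hFh 1).continuous_fderiv one_ne_zero).clm_apply continuous_const)
    ((hFhc 1).fderiv_apply ℝ Complex.I) (integral_fderiv_apply_eq_zero (hFh 1) (hFhc 1) Complex.I)
  obtain ⟨hJi, hJ⟩ := integral_jacobian_eq_zero (B := max B₁ B₂) hv hA (by
      rintro h (rfl | rfl) x
      · exact (hB₁ x).trans (by gcongr; exact le_max_left _ _)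
      · exact (hB₂ x).trans (by gcongr; exact le_max_right _ _))
    (fun x => by
      rw [hvd 1, fderiv_Kconv θ (hFh 1) (hFhc 1)]
      exact hD x)
  have hPc : ∀ h : ℂ, Continuous fun y => fderiv ℝ v y h := fun h => by
    rw [hvd]; exact continuous_Kconv θ (hFh h).continuous (hFhc h)
  have hdc : Continuous fun x => (fderiv ℝ v x 1).re + (fderiv ℝ v x Complex.I).im :=
    (Complex.continuous_re.comp (hPc 1)).add (Complex.continuous_im.comp (hPc Complex.I))
  have hfc : HasCompactSupport fun x => f x ^ 2 := by
    simp only [pow_two]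
    exact hc.mul_left (f := f)
  have hfi : Integrable fun x => f x ^ 2 :=
    (hf.continuous.pow 2).integrable_of_hasCompactSupport hfc
  have hpt : ∀ x, ((fderiv ℝ v x 1).re + (fderiv ℝ v x Complex.I).im) ^ 2 ≤ f x ^ 2 +
      4 * ((fderiv ℝ v x 1).re * (fderiv ℝ v x Complex.I).im
        - (fderiv ℝ v x Complex.I).re * (fderiv ℝ v x 1).im) := fun x => by
    have h1 := dbar_Kconv θ hF1 hFc x
    rw [← hvf, hFf] at h1
    exact add_sq_le_of_add_I_mul_eq (Complex.norm_exp_ofReal_mul_I θ) h1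
  have hbi := hfi.add (hJi.const_mul 4)
  have hdi : Integrable fun x => ((fderiv ℝ v x 1).re + (fderiv ℝ v x Complex.I).im) ^ 2 :=
    hbi.mono' (hdc.pow 2).aestronglyMeasurable (Filter.Eventually.of_forall fun x => by
      rw [Real.norm_of_nonneg (sq_nonneg _)]
      exact hpt x)
  refine ⟨hdi, (integral_mono hdi hbi hpt).trans_eq ?_⟩
  simp only [Pi.add_apply]
  rw [integral_add hfi (hJi.const_mul 4), integral_const_mul, hJ, mul_zero, add_zero]

end DivergenceEstimate

section Slices

variable {F : Type*} [NormedAddCommGroup F] [NormedSpace ℝ F] {Φ : ℝ × ℂ → F}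

lemma fderiv_slice_right (hΦ : Differentiable ℝ Φ) (t : ℝ) (z h : ℂ) :
    fderiv ℝ (fun y => Φ (t, y)) z h = fderiv ℝ Φ (t, z) (0, h) := by
  have := (hΦ (t, z)).hasFDerivAt.comp z (hasFDerivAt_prodMk_right t z)
  rw [HasFDerivAt.fderiv (f := fun y => Φ (t, y)) this]
  simp

lemma hasDerivAt_slice_left (hΦ : Differentiable ℝ Φ) (t : ℝ) (z : ℂ) :
    HasDerivAt (fun s => Φ (s, z)) (fderiv ℝ Φ (t, z) (1, 0)) t :=
  (hΦ (t, z)).hasFDerivAt.comp_hasDerivAt t ((hasDerivAt_id t).prodMk (hasDerivAt_const t z))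

lemma hasDerivAt_fderiv_slice (hΦ : ContDiff ℝ 2 Φ) (t : ℝ) (z h : ℂ) :
    HasDerivAt (fun s => fderiv ℝ (fun y => Φ (s, y)) z h)
      (fderiv ℝ (fun y => deriv (fun s => Φ (s, y)) t) z h) t := by
  have hd : Differentiable ℝ Φ := hΦ.differentiable two_ne_zero
  have hD : Differentiable ℝ (fderiv ℝ Φ) :=
    (hΦ.fderiv_right (m := 1) (by norm_num)).differentiable one_ne_zero
  have hsymm : IsSymmSndFDerivAt ℝ Φ (t, z) := hΦ.contDiffAt.isSymmSndFDerivAt (by simp)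
  have hDapp : ∀ q : ℝ × ℂ, Differentiable ℝ fun p => fderiv ℝ Φ p q := fun q =>
    hD.clm_apply (differentiable_const q)
  have key : ∀ q k : ℝ × ℂ, fderiv ℝ (fun p => fderiv ℝ Φ p q) (t, z) k =
      fderiv ℝ (fderiv ℝ Φ) (t, z) k q := fun q k => by
    rw [fderiv_clm_apply (hD _) (differentiableAt_const q)]
    simp
  simp only [fderiv_slice_right hd, fun y => (hasDerivAt_slice_left hd t y).deriv]
  rw [fderiv_slice_right (Φ := fun p => fderiv ℝ Φ p (1, 0)) (hDapp _), key, ← hsymm.eq, ← key]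
  exact hasDerivAt_slice_left (hDapp _) t z

end Slices

section PlanarDeterminant

lemma det_eq_re_mul_im_sub (L : ℂ →L[ℝ] ℂ) :
    LinearMap.det (L : ℂ →ₗ[ℝ] ℂ) = (L 1).re * (L Complex.I).im - (L Complex.I).re * (L 1).im := by
  rw [← LinearMap.det_toMatrix Complex.basisOneI, Matrix.det_fin_two]
  simp [LinearMap.toMatrix_apply]

lemma apply_eq_re_smul_add_im_smul {F : Type*} [NormedAddCommGroup F] [NormedSpace ℝ F]
    (L : ℂ →L[ℝ] F) (z : ℂ) : L z = z.re • L 1 + z.im • L Complex.I := by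
  rw [← map_smul, ← map_smul, ← map_add]
  congr 1
  apply Complex.ext <;> simp

/-- Liouville's formula in the plane. -/
lemma hasDerivAt_det_of_hasDerivAt {M : ℝ → ℂ →L[ℝ] ℂ} {L : ℂ →L[ℝ] ℂ} {t : ℝ}
    (hM : ∀ h, HasDerivAt (fun s => M s h) (L (M t h)) t) :
    HasDerivAt (fun s => LinearMap.det (M s : ℂ →ₗ[ℝ] ℂ))
      (((L 1).re + (L Complex.I).im) * LinearMap.det (M t : ℂ →ₗ[ℝ] ℂ)) t := by
  simp only [det_eq_re_mul_im_sub]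
  have hre : ∀ h, HasDerivAt (fun s => (M s h).re) (L (M t h)).re t := fun h => by
    have := (Complex.reCLM.hasFDerivAt (x := M t h)).comp_hasDerivAt t (hM h)
    exact this
  have him : ∀ h, HasDerivAt (fun s => (M s h).im) (L (M t h)).im t := fun h => by
    have := (Complex.imCLM.hasFDerivAt (x := M t h)).comp_hasDerivAt t (hM h)
    exact this
  refine (((hre 1).mul (him Complex.I)).sub ((hre Complex.I).mul (him 1))).congr_deriv ?_
  rw [apply_eq_re_smul_add_im_smul L (M t 1), apply_eq_re_smul_add_im_smul L (M t Complex.I)]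
  simp only [Complex.add_re, Complex.add_im, Complex.real_smul, Complex.re_ofReal_mul,
    Complex.im_ofReal_mul]
  ring

end PlanarDeterminant

lemma abs_le_supNorm {g : ℂ → ℝ} (hg : Continuous g) (hc : HasCompactSupport g) (z : ℂ) :
    |g z| ≤ supNorm g := by
  obtain ⟨C, hC⟩ := hc.exists_bound_of_continuous hg
  exact le_ciSup (f := fun z => |g z|) ⟨C, by rintro _ ⟨z, rfl⟩; exact hC z⟩ z

lemma hasDerivAt_setIntegral_of_contDiff {G : ℝ × ℂ → ℝ} (hG : ContDiff ℝ 1 G) {E : Set ℂ}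
    (hE : IsCompact E) (t : ℝ) :
    HasDerivAt (fun s => ∫ z in E, G (s, z)) (∫ z in E, deriv (fun s => G (s, z)) t) t := by
  have hd : Differentiable ℝ G := hG.differentiable one_ne_zero
  have hc : Continuous fun p => fderiv ℝ G p (1, 0) :=
    (hG.continuous_fderiv one_ne_zero).clm_apply continuous_const
  obtain ⟨C, hC⟩ := ((isCompact_Icc (a := t - 1) (b := t + 1)).prod hE).exists_bound_of_continuousOn
    hc.continuousOn
  simp only [fun z => (hasDerivAt_slice_left hd t z).deriv]
  refine (hasDerivAt_integral_of_dominated_loc_of_deriv_le (μ := volume.restrict E)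
    (F := fun s z => G (s, z)) (F' := fun s z => fderiv ℝ G (s, z) (1, 0)) (bound := fun _ => C)
    (Icc_mem_nhds (sub_one_lt t) (lt_add_one t)) ?_ ?_ ?_ ?_ ?_ ?_).2
  · exact Filter.Eventually.of_forall fun s =>
      (hG.continuous.comp (Continuous.prodMk_right s)).aestronglyMeasurable
  · exact (hG.continuous.comp (Continuous.prodMk_right t)).continuousOn.integrableOn_compact hE
  · exact (hc.comp (Continuous.prodMk_right t)).aestronglyMeasurable
  · filter_upwards [ae_restrict_mem hE.measurableSet] with z hz s hs
    exact hC (s, z) ⟨hs, hz⟩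
  · exact integrableOn_const hE.measure_lt_top.ne
  · exact Filter.Eventually.of_forall fun z s _ => hasDerivAt_slice_left hd s z

lemma le_mul_exp_of_hasDerivAt_le {A A' : ℝ → ℝ} {M T : ℝ}
    (hA : ∀ t ∈ Set.Icc 0 T, HasDerivAt A (A' t) t) (hle : ∀ t ∈ Set.Icc 0 T, A' t ≤ M * A t)
    {t : ℝ} (ht : t ∈ Set.Icc 0 T) : A t ≤ Real.exp (t * M) * A 0 := by
  have hd : ∀ s ∈ Set.Icc 0 T, HasDerivAt (fun s => A s * Real.exp (-(s * M)))
      (A' s * Real.exp (-(s * M)) + A s * (Real.exp (-(s * M)) * -(1 * M))) s := fun s hs =>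
    (hA s hs).mul (((hasDerivAt_id s).mul_const M).neg.exp)
  have hanti : AntitoneOn (fun s => A s * Real.exp (-(s * M))) (Set.Icc 0 T) := by
    refine antitoneOn_of_deriv_nonpos (convex_Icc 0 T)
      (fun s hs => (hd s hs).continuousAt.continuousWithinAt)
      (fun s hs => (hd s (interior_subset hs)).differentiableAt.differentiableWithinAt)
      fun s hs => ?_
    rw [(hd s (interior_subset hs)).deriv]
    have := mul_le_mul_of_nonneg_right (hle s (interior_subset hs)) (Real.exp_pos (-(s * M))).le
    linarith
  have h0 := hanti (Set.left_mem_Icc.2 (ht.1.trans ht.2)) ht ht.1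
  simp only [zero_mul, neg_zero, Real.exp_zero, mul_one] at h0
  calc A t = Real.exp (t * M) * (A t * Real.exp (-(t * M))) := by
        rw [mul_comm (A t), ← mul_assoc, ← Real.exp_add, add_neg_cancel, Real.exp_zero, one_mul]
    _ ≤ Real.exp (t * M) * A 0 := by gcongr

namespace SmoothSetting

variable (S : SmoothSetting)

/-- The velocity field `v(t,·) = K ∗ ω(t,·)`. -/
noncomputable def velocity (t : ℝ) : ℂ → ℂ := Kconv S.θ fun y => (S.ω t y : ℂ)

/-- The divergence of the velocity field. -/
noncomputable def divergence (t : ℝ) (z : ℂ) : ℝ :=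
  (fderiv ℝ (S.velocity t) z 1).re + (fderiv ℝ (S.velocity t) z Complex.I).im

/-- The Jacobian determinant of the flow. -/
noncomputable def jacobian (t : ℝ) (z : ℂ) : ℝ :=
  LinearMap.det (fderiv ℝ (S.X t) z : ℂ →ₗ[ℝ] ℂ)

lemma contDiff_omega (t : ℝ) : ContDiff ℝ (⊤ : ℕ∞) (S.ω t) :=
  S.hωsmooth.comp (contDiff_const.prodMk contDiff_id : ContDiff ℝ (⊤ : ℕ∞) fun z : ℂ => (t, z))

lemma contDiff_flow (t : ℝ) : ContDiff ℝ (⊤ : ℕ∞) (S.X t) :=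
  S.hXsmooth.comp (contDiff_const.prodMk contDiff_id : ContDiff ℝ (⊤ : ℕ∞) fun z : ℂ => (t, z))

lemma differentiable_flow (t : ℝ) : Differentiable ℝ (S.X t) :=
  (S.contDiff_flow t).differentiable (by simp)

lemma contDiff_velocity (t : ℝ) : ContDiff ℝ (⊤ : ℕ∞) (S.velocity t) :=
  contDiff_Kconv S.θ (Complex.ofRealCLM.contDiff.comp (S.contDiff_omega t))
    ((S.hωsupp t).comp_left (g := fun r : ℝ => (r : ℂ)) Complex.ofReal_zero)

lemma continuous_divergence (t : ℝ) : Continuous (S.divergence t) := by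
  have h : ∀ h : ℂ, Continuous fun z => fderiv ℝ (S.velocity t) z h := fun h =>
    ((S.contDiff_velocity t).continuous_fderiv (by simp)).clm_apply continuous_const
  exact (Complex.continuous_re.comp (h 1)).add (Complex.continuous_im.comp (h Complex.I))

lemma contDiff_jacobian : ContDiff ℝ 1 fun p : ℝ × ℂ => S.jacobian p.1 p.2 := by
  have h2 : ContDiff ℝ 2 fun p : ℝ × ℂ => S.X p.1 p.2 := by
    exact_mod_cast contDiff_infty.1 S.hXsmooth 2
  have hd : Differentiable ℝ fun p : ℝ × ℂ => S.X p.1 p.2 := h2.differentiable two_ne_zero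
  have hD : ∀ h : ℂ, ContDiff ℝ 1 fun p : ℝ × ℂ => fderiv ℝ (S.X p.1) p.2 h := fun h => by
    have heq : (fun p : ℝ × ℂ => fderiv ℝ (S.X p.1) p.2 h) =
        fun p : ℝ × ℂ => fderiv ℝ (fun p : ℝ × ℂ => S.X p.1 p.2) p (0, h) :=
      funext fun p => fderiv_slice_right hd p.1 p.2 h
    rw [heq]
    exact (h2.fderiv_right (m := 1) (by norm_num)).clm_apply contDiff_const
  simp only [jacobian, det_eq_re_mul_im_sub]
  exact ((Complex.reCLM.contDiff.comp (hD 1)).mul (Complex.imCLM.contDiff.comp (hD Complex.I))).sub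
    ((Complex.reCLM.contDiff.comp (hD Complex.I)).mul (Complex.imCLM.contDiff.comp (hD 1)))

lemma continuous_jacobian (t : ℝ) : Continuous (S.jacobian t) :=
  S.contDiff_jacobian.continuous.comp (Continuous.prodMk_right t)

lemma jacobian_zero (z : ℂ) : S.jacobian 0 z = 1 := by
  have : S.X 0 = id := funext S.hXinit
  simp [jacobian, this]

variable {S} {t : ℝ}

lemma hasDerivAt_flow (ht : t ∈ Set.Icc 0 S.T) (z : ℂ) :
    HasDerivAt (fun s => S.X s z) (S.velocity t (S.X t z)) t := by
  have := hasDerivAt_slice_left (S.hXsmooth.differentiable (by simp)) t z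
  have h := this.deriv
  rw [S.hXflow t ht z] at h
  exact this.congr_deriv h.symm

/-- The solution is transported by the flow. -/
lemma omega_flow (ht : t ∈ Set.Icc 0 S.T) (z : ℂ) : S.ω t (S.X t z) = S.ω₀ z := by
  let W : ℝ × ℂ → ℝ := fun p => S.ω p.1 p.2
  have hW : Differentiable ℝ W := S.hωsmooth.differentiable (by simp)
  have hd : ∀ s ∈ Set.Icc 0 S.T, HasDerivAt (fun s => S.ω s (S.X s z)) 0 s := fun s hs => by
    have h1 := (hW (s, S.X s z)).hasFDerivAt.comp_hasDerivAt s
      ((hasDerivAt_id s).prodMk (hasDerivAt_flow hs z))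
    refine HasDerivAt.congr_deriv (f := fun s => S.ω s (S.X s z)) h1 ?_
    have h2 := S.htransport s hs (S.X s z)
    have h3 : deriv (fun s' => S.ω s' (S.X s z)) s = fderiv ℝ W (s, S.X s z) (1, 0) :=
      (hasDerivAt_slice_left hW s (S.X s z)).deriv
    have h4 : ∀ h, fderiv ℝ (S.ω s) (S.X s z) h = fderiv ℝ W (s, S.X s z) (0, h) :=
      fderiv_slice_right hW s (S.X s z)
    have h5 := apply_eq_re_smul_add_im_smul (fderiv ℝ (S.ω s) (S.X s z)) (S.velocity s (S.X s z))
    have h6 : ((1 : ℝ), S.velocity s (S.X s z)) = (1, 0) + (0, S.velocity s (S.X s z)) := by simp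
    rw [h6, map_add, ← h4, h5, ← h3, smul_eq_mul, smul_eq_mul, ← add_assoc]
    exact h2
  have hconst := constant_of_has_deriv_right_zero (f := fun s => S.ω s (S.X s z)) (a := 0)
    (b := S.T) (fun s hs => (hd s hs).continuousAt.continuousWithinAt)
    (fun s hs => (hd s (Set.Ico_subset_Icc_self hs)).hasDerivWithinAt) t ht
  simpa only [S.hXinit, S.hωinit] using hconst

/-- Liouville's formula for the flow. -/
lemma hasDerivAt_jacobian (ht : t ∈ Set.Icc 0 S.T) (z : ℂ) :
    HasDerivAt (fun s => S.jacobian s z) (S.divergence t (S.X t z) * S.jacobian t z) t := by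
  have h2 : ContDiff ℝ 2 fun p : ℝ × ℂ => S.X p.1 p.2 := by
    exact_mod_cast contDiff_infty.1 S.hXsmooth 2
  refine hasDerivAt_det_of_hasDerivAt (M := fun s => fderiv ℝ (S.X s) z) fun h => ?_
  refine (hasDerivAt_fderiv_slice h2 t z h).congr_deriv ?_
  have heq : (fun y => deriv (fun s => S.X s y) t) = fun y => S.velocity t (S.X t y) :=
    funext fun y => (hasDerivAt_flow ht y).deriv
  have hcomp := (((S.contDiff_velocity t).differentiable (by simp)) (S.X t z)).hasFDerivAt.comp z
    (S.differentiable_flow t z).hasFDerivAt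
  have hfd : fderiv ℝ (fun y => S.velocity t (S.X t y)) z =
      (fderiv ℝ (S.velocity t) (S.X t z)).comp (fderiv ℝ (S.X t) z) := hcomp.fderiv
  simp only [heq, hfd, ContinuousLinearMap.comp_apply]

lemma jacobian_pos (ht : t ∈ Set.Icc 0 S.T) (z : ℂ) : 0 < S.jacobian t z := S.hXjac t ht z

lemma abs_det_fderiv_flow (ht : t ∈ Set.Icc 0 S.T) (z : ℂ) :
    |(fderiv ℝ (S.X t) z).det| = S.jacobian t z :=
  abs_of_pos (jacobian_pos ht z)

/-- Change of variables along the flow. -/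
lemma integral_eq_integral_jacobian_mul (ht : t ∈ Set.Icc 0 S.T) (g : ℂ → ℝ) :
    ∫ z, g z = ∫ z, S.jacobian t z * g (S.X t z) := by
  have := integral_image_eq_integral_abs_det_fderiv_smul volume MeasurableSet.univ
    (fun z _ => (S.differentiable_flow t z).hasFDerivAt.hasFDerivWithinAt)
    (S.hXbij t ht).1.injOn g
  simpa only [Set.image_univ, (S.hXbij t ht).2.range_eq, setIntegral_univ, smul_eq_mul,
    abs_det_fderiv_flow ht] using this

lemma integrable_jacobian_mul (ht : t ∈ Set.Icc 0 S.T) {g : ℂ → ℝ} (hg : Integrable g) :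
    Integrable fun z => S.jacobian t z * g (S.X t z) := by
  have := integrableOn_image_iff_integrableOn_abs_det_fderiv_smul volume MeasurableSet.univ
    (fun z _ => (S.differentiable_flow t z).hasFDerivAt.hasFDerivWithinAt)
    (S.hXbij t ht).1.injOn g
  simpa only [Set.image_univ, (S.hXbij t ht).2.range_eq, integrableOn_univ, smul_eq_mul,
    abs_det_fderiv_flow ht, hg, true_iff] using this

lemma integrableOn_tsupport {g : ℂ → ℝ} (hg : Continuous g) :
    IntegrableOn g (tsupport S.ω₀) :=
  hg.continuousOn.integrableOn_compact S.hω₀supp.isCompact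

lemma abs_omega_zero_le (z : ℂ) : |S.ω₀ z| ≤ supNorm S.ω₀ :=
  abs_le_supNorm S.hω₀smooth.continuous S.hω₀supp z

lemma supNorm_omega_zero_nonneg : 0 ≤ supNorm S.ω₀ :=
  (abs_nonneg _).trans (abs_omega_zero_le 0)

/-- A power of the solution is controlled by the area of the transported support. -/
lemma integral_abs_omega_pow_le (ht : t ∈ Set.Icc 0 S.T) {n : ℕ} (hn : n ≠ 0) :
    ∫ z, |S.ω t z| ^ n ≤ supNorm S.ω₀ ^ n * ∫ z in tsupport S.ω₀, S.jacobian t z := by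
  have hzero : ∀ z ∉ tsupport S.ω₀, S.jacobian t z * |S.ω₀ z| ^ n = 0 := fun z hz => by
    simp [image_eq_zero_of_notMem_tsupport hz, hn]
  rw [integral_eq_integral_jacobian_mul ht fun z => |S.ω t z| ^ n]
  simp only [omega_flow ht]
  rw [← setIntegral_eq_integral_of_forall_compl_eq_zero hzero, ← integral_const_mul]
  have hJ := S.continuous_jacobian t
  have hω := S.hω₀smooth.continuous
  refine integral_mono (integrableOn_tsupport (by fun_prop)) (integrableOn_tsupport (by fun_prop))
    fun z => ?_
  have := jacobian_pos ht z
  calc S.jacobian t z * |S.ω₀ z| ^ n ≤ S.jacobian t z * supNorm S.ω₀ ^ n := by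
        gcongr
        exact abs_omega_zero_le z
    _ = supNorm S.ω₀ ^ n * S.jacobian t z := mul_comm _ _

lemma setIntegral_divergence_mul_jacobian_le (ht : t ∈ Set.Icc 0 S.T) (hM : 0 < supNorm S.ω₀) :
    ∫ z in tsupport S.ω₀, S.divergence t (S.X t z) * S.jacobian t z ≤
      supNorm S.ω₀ * ∫ z in tsupport S.ω₀, S.jacobian t z := by
  have hJ := S.continuous_jacobian t
  have hdX : Continuous fun z => S.divergence t (S.X t z) :=
    (S.continuous_divergence t).comp (S.contDiff_flow t).continuous
  obtain ⟨hdi, hd⟩ := integral_div_Kconv_sq_le S.θ (S.contDiff_omega t) (S.hωsupp t)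
    (v := S.velocity t) rfl
  change Integrable fun z => S.divergence t z ^ 2 at hdi
  change ∫ z, S.divergence t z ^ 2 ≤ _ at hd
  set M := supNorm S.ω₀
  set A := ∫ z in tsupport S.ω₀, S.jacobian t z
  have hω : ∫ z, S.ω t z ^ 2 ≤ M ^ 2 * A := by
    simpa only [sq_abs] using integral_abs_omega_pow_le ht two_ne_zero
  have hsq : ∫ z in tsupport S.ω₀, S.jacobian t z * S.divergence t (S.X t z) ^ 2 ≤ M ^ 2 * A := by
    refine le_trans ?_ (hd.trans hω)
    rw [integral_eq_integral_jacobian_mul ht fun z => S.divergence t z ^ 2]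
    exact setIntegral_le_integral (integrable_jacobian_mul ht hdi)
      (Filter.Eventually.of_forall fun z => mul_nonneg (jacobian_pos ht z).le (sq_nonneg _))
  have hi₁ : IntegrableOn (fun z => M / 2 * S.jacobian t z) (tsupport S.ω₀) :=
    integrableOn_tsupport (by fun_prop)
  have hi₂ : IntegrableOn (fun z => (2 * M)⁻¹ * (S.jacobian t z * S.divergence t (S.X t z) ^ 2))
      (tsupport S.ω₀) := integrableOn_tsupport (by fun_prop)
  calc ∫ z in tsupport S.ω₀, S.divergence t (S.X t z) * S.jacobian t z
      ≤ ∫ z in tsupport S.ω₀, (M / 2 * S.jacobian t z +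
          (2 * M)⁻¹ * (S.jacobian t z * S.divergence t (S.X t z) ^ 2)) := by
        refine integral_mono (integrableOn_tsupport (by fun_prop)) (hi₁.add hi₂) fun z => ?_
        have h1 : S.divergence t (S.X t z) ≤
            M / 2 + (2 * M)⁻¹ * S.divergence t (S.X t z) ^ 2 := by
          have h2 : M / 2 + (2 * M)⁻¹ * S.divergence t (S.X t z) ^ 2 - S.divergence t (S.X t z)
              = (2 * M)⁻¹ * (M - S.divergence t (S.X t z)) ^ 2 := by
            field_simp
            ring
          have h3 : 0 ≤ (2 * M)⁻¹ * (M - S.divergence t (S.X t z)) ^ 2 := by positivity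
          linarith
        have h4 := mul_le_mul_of_nonneg_right h1 (jacobian_pos ht z).le
        dsimp only
        linarith
    _ = M / 2 * A + (2 * M)⁻¹ *
          ∫ z in tsupport S.ω₀, S.jacobian t z * S.divergence t (S.X t z) ^ 2 := by
        rw [integral_add hi₁ hi₂, integral_const_mul, integral_const_mul]
    _ ≤ M / 2 * A + (2 * M)⁻¹ * (M ^ 2 * A) := by gcongr
    _ = M * A := by
        field_simp
        ring

/-- The area of the transported support grows at most exponentially. -/
lemma setIntegral_jacobian_le (ht : t ∈ Set.Icc 0 S.T) (hM : 0 < supNorm S.ω₀) :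
    ∫ z in tsupport S.ω₀, S.jacobian t z ≤
      Real.exp (t * supNorm S.ω₀) * (volume (tsupport S.ω₀)).toReal := by
  have hA : ∀ s ∈ Set.Icc 0 S.T, HasDerivAt (fun s => ∫ z in tsupport S.ω₀, S.jacobian s z)
      (∫ z in tsupport S.ω₀, S.divergence s (S.X s z) * S.jacobian s z) s := fun s hs =>
    (hasDerivAt_setIntegral_of_contDiff S.contDiff_jacobian S.hω₀supp.isCompact s).congr_deriv
      (by simp only [fun z => (hasDerivAt_jacobian hs z).deriv])
  have h := le_mul_exp_of_hasDerivAt_le hA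
    (fun s hs => setIntegral_divergence_mul_jacobian_le hs hM) ht
  simpa [jacobian_zero, Measure.real] using h

end SmoothSetting

/-- in the smooth setting, the `L¹` norm of the solution grows at most
exponentially: `∫ |ω(t,z)| dA(z) ≤ ‖ω₀‖_∞ · e^{t‖ω₀‖_∞} · |supp ω₀|`. -/
theorem L1_norm_growth (S : SmoothSetting) :
    ∀ t ∈ Set.Icc (0 : ℝ) S.T,
      (∫ z : ℂ, |S.ω t z|) ≤
        supNorm S.ω₀ * Real.exp (t * supNorm S.ω₀) * (volume (tsupport S.ω₀)).toReal := by
  intro t ht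
  have h1 := SmoothSetting.integral_abs_omega_pow_le ht one_ne_zero
  simp only [pow_one] at h1
  rcases (SmoothSetting.supNorm_omega_zero_nonneg (S := S)).eq_or_lt with hM | hM
  · simpa [← hM] using h1
  · refine h1.trans ?_
    rw [mul_assoc]
    gcongr
    exact SmoothSetting.setIntegral_jacobian_le ht hM
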